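/- Let A and B be bounded distributive lattices, d : A → B an order-reversing bijection whose inverse d⁻¹ is also order-reversing, I⁺ an ideal of A and I⁻ an ideal of B. Then b ≤ d(a) holds for all a ∈ I⁺ and all b ∈ I⁻ if and only if there is no prime ideal P of A for which both some a ∈ I⁺ satisfies a ∉ P and some b ∈ I⁻ satisfies d⁻¹(b) ∈ P. -/

import Mathlib

/-- An ideal of a lattice: a nonempty, downward-closed subset closed under
binary joins. -/
def IsLatIdeal {L : Type*} [Lattice L] (I : Set L) : Prop :=
  I.Nonempty ∧ (∀ x y : L, x ≤ y → y ∈ I → x ∈ I) ∧ (∀ x ∈ I, ∀ y ∈ I, x ⊔ y ∈ I)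

/-- A filter of a lattice: a nonempty, upward-closed subset closed under
binary meets. -/
def IsLatFilter {L : Type*} [Lattice L] (F : Set L) : Prop :=
  F.Nonempty ∧ (∀ x y : L, x ≤ y → x ∈ F → y ∈ F) ∧ (∀ x ∈ F, ∀ y ∈ F, x ⊓ y ∈ F)

/-- A prime ideal of a lattice: a proper ideal `I` such that `x ⊓ y ∈ I` implies
`x ∈ I` or `y ∈ I`. -/
def IsPrimeLatIdeal {L : Type*} [Lattice L] (I : Set L) : Prop :=
  IsLatIdeal I ∧ I ≠ Set.univ ∧ ∀ x y : L, x ⊓ y ∈ I → x ∈ I ∨ y ∈ I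

/-- In a distributive lattice, if `a ≰ c` then some prime ideal contains `c` but not `a`. -/
theorem exists_isPrimeLatIdeal_of_not_le {L : Type*} [DistribLattice L] {a c : L}
    (h : ¬ a ≤ c) : ∃ P : Set L, IsPrimeLatIdeal P ∧ a ∉ P ∧ c ∈ P := by
  have hdisj : Disjoint (Order.PFilter.principal a : Set L) (Order.Ideal.principal c : Set L) :=
    Set.disjoint_left.2 fun _ hax hxc =>
      h ((Order.PFilter.mem_principal.1 hax).trans (Order.Ideal.mem_principal.1 hxc))
  obtain ⟨J, hJ, hcJ, hJa⟩ := DistribLattice.prime_ideal_of_disjoint_filter_ideal hdisj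
  refine ⟨J, ⟨⟨J.nonempty, fun _ _ hxy hy => J.lower hxy hy,
    fun _ hx _ hy => Order.Ideal.sup_mem hx hy⟩, hJ.ne_univ, fun _ _ => hJ.mem_or_mem⟩, ?_,
    Order.Ideal.principal_le_iff.1 hcJ⟩
  exact Set.disjoint_left.1 hJa (Order.PFilter.mem_principal.2 le_rfl)

/-- `(Ip, Im)` is consistent (i.e. `b ≤ d a` for all `a ∈ Ip`, `b ∈ Im`) iff no
prime ideal `P` of `A` witnesses the contrary. -/
theorem con_ideal_iff_no_prime_witness
    {A B : Type*} [DistribLattice A] [BoundedOrder A]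
    [DistribLattice B] [BoundedOrder B]
    (d : A → B) (dinv : B → A)
    (hleft : ∀ a : A, dinv (d a) = a) (hright : ∀ b : B, d (dinv b) = b)
    (hd : ∀ a a' : A, a ≤ a' → d a' ≤ d a)
    (hdinv : ∀ b b' : B, b ≤ b' → dinv b' ≤ dinv b)
    (Ip : Set A) (Im : Set B)
    (hIp : IsLatIdeal Ip) (hIm : IsLatIdeal Im) :
    (∀ a ∈ Ip, ∀ b ∈ Im, b ≤ d a) ↔
      ¬ ∃ P : Set A, IsPrimeLatIdeal P ∧
        (∃ a ∈ Ip, a ∉ P) ∧ (∃ b ∈ Im, dinv b ∈ P) := by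
  constructor
  · rintro h ⟨P, hP, ⟨a, ha, haP⟩, b, hb, hbP⟩
    have hab : a ≤ dinv b := by simpa only [hleft] using hdinv _ _ (h a ha b hb)
    exact haP (hP.1.2.1 _ _ hab hbP)
  · intro h a ha b hb
    by_contra hba
    have hab : ¬ a ≤ dinv b := fun hle => hba (by simpa only [hright] using hd _ _ hle)
    obtain ⟨P, hP, haP, hbP⟩ := exists_isPrimeLatIdeal_of_not_le hab
    exact h ⟨P, hP, ⟨a, ha, haP⟩, b, hb, hbP⟩
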